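/- arXiv:2105.12157 — 2 statements merged into one kernel-verified Lean document; each statement's English description precedes it below -/
import Mathlib

section
/- The quantifier 'there is one and only one' (∃!) is not a logical quantifier: there is no quantifier function f such that for every nonempty type α and every predicate p : α → Bool, f applied to the truth-value set T(p) = {b : Bool | ∃ x, p x = b} equals decide (∃! x, p x = true). (For instance, over a one-element domain with p constantly true and over a two-element domain with p constantly true, the truth-value set is {true} in both cases, but ∃! holds in the first and fails in the second.) -/
open scoped Classical in
theorem stmt9 : ¬ ∃ f : {s : Set Bool // s.Nonempty} → Bool,
    ∀ (α : Type) [Nonempty α] (p : α → Bool)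
      (h : ({b : Bool | ∃ x, p x = b} : Set Bool).Nonempty),
      f ⟨{b : Bool | ∃ x, p x = b}, h⟩ = decide (∃! x, p x = true) := by 
  rintro ⟨f, hf⟩
  have h1 := hf Unit (fun _ => true) ⟨true, (), rfl⟩
  have h2 := hf Bool (fun _ => true) ⟨true, true, rfl⟩
  have e : (⟨{b : Bool | ∃ _ : Unit, true = b}, ⟨true, (), rfl⟩⟩ : {s : Set Bool // s.Nonempty})
      = ⟨{b : Bool | ∃ _ : Bool, true = b}, ⟨true, true, rfl⟩⟩ := by
    apply Subtype.ext
    ext b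
    simp
  have h3 := h1.symm.trans ((congrArg f e).trans h2)
  have a : ∃! x : Unit, (fun _ : Unit => true) x = true := ⟨(), rfl, fun _ _ => rfl⟩
  have b : ¬ ∃! x : Bool, (fun _ : Bool => true) x = true := by
    intro h
    exact Bool.noConfusion (h.unique (y₁ := true) (y₂ := false) rfl rfl)
  rw [decide_eq_true a, decide_eq_false b] at h3
  exact Bool.noConfusion h3
end

section
/- The cardinal quantifier 'there exist at least two' is not a logical quantifier: there is no quantifier function f such that for every nonempty type α and every predicate p : α → Bool, f applied to the truth-value set T(p) = {b : Bool | ∃ x, p x = b} equals decide (∃ x y, x ≠ y ∧ p x = true ∧ p y = true). -/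
open scoped Classical in
theorem stmt10 : ¬ ∃ f : {s : Set Bool // s.Nonempty} → Bool,
    ∀ (α : Type) [Nonempty α] (p : α → Bool)
      (h : ({b : Bool | ∃ x, p x = b} : Set Bool).Nonempty),
      f ⟨{b : Bool | ∃ x, p x = b}, h⟩ =
        decide (∃ x y : α, x ≠ y ∧ p x = true ∧ p y = true) := by
  rintro ⟨f, hf⟩
  have h1 := hf Unit (fun _ => true) ⟨true, (), rfl⟩
  have h2 := hf Bool (fun _ => true) ⟨true, true, rfl⟩
  have e : (⟨{b : Bool | ∃ _ : Unit, true = b}, ⟨true, (), rfl⟩⟩ : {s : Set Bool // s.Nonempty})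
      = ⟨{b : Bool | ∃ _ : Bool, true = b}, ⟨true, true, rfl⟩⟩ := by
    apply Subtype.ext
    ext b
    exact ⟨fun ⟨_, h⟩ => ⟨true, h⟩, fun ⟨_, h⟩ => ⟨(), h⟩⟩
  have h3 := h1.symm.trans ((congrArg f e).trans h2)
  have h4 : ∃ x y : Unit, x ≠ y ∧ true = true ∧ true = true :=
    (decide_eq_decide.mp h3).mpr ⟨true, false, Bool.noConfusion, rfl, rfl⟩
  obtain ⟨x, y, hxy, -⟩ := h4
  exact hxy rfl
end
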